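/- arXiv:1105.0185 — 2 statements merged into one kernel-verified Lean document; each statement's English description precedes it below -/
import Mathlib

section
/- For every φ ∈ S²₋, the operator σ₂φ belongs to K₋ (i.e., σ₂φ is an affine curvature operator, commutes with J, and satisfies (σ₂φ)(Jx,Jy) = -(σ₂φ)(x,y)), and ρ(σ₂φ) = (2-m)φ. -/
open Module

variable {V : Type*} [AddCommGroup V] [Module ℝ V]

/-- `A` is an affine curvature operator. -/
def IsAff (A : V →ₗ[ℝ] V →ₗ[ℝ] V →ₗ[ℝ] V) : Prop :=
  (∀ x y, A x y = - A y x) ∧ ∀ x y z, A x y z + A y z x + A z x y = 0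

/-- The Ricci tensor `ρ(A)(x,y) = Tr (z ↦ A(z,x)y)`. -/
noncomputable def rho (A : V →ₗ[ℝ] V →ₗ[ℝ] V →ₗ[ℝ] V) (x y : V) : ℝ :=
  LinearMap.trace ℝ V ((A.flip x).flip y)

/-- `A` is an affine Kähler curvature operator: `A ∈ 𝔄` and `A(x,y)` commutes with `J`. -/
def IsK (J : V →ₗ[ℝ] V) (A : V →ₗ[ℝ] V →ₗ[ℝ] V →ₗ[ℝ] V) : Prop :=
  IsAff A ∧ ∀ x y z, A x y (J z) = J (A x y z)

/-- `A ∈ K₋`. -/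
def IsKminus (J : V →ₗ[ℝ] V) (A : V →ₗ[ℝ] V →ₗ[ℝ] V →ₗ[ℝ] V) : Prop :=
  IsK J A ∧ ∀ x y, A (J x) (J y) = - A x y

theorem trace_J_zero {W : Type*} [AddCommGroup W] [Module ℝ W] [FiniteDimensional ℝ W]
    (J : W →ₗ[ℝ] W) (hJ : ∀ v, J (J v) = -v) : LinearMap.trace ℝ W J = 0 := by
  let E : Module.End ℂ (TensorProduct ℝ ℂ W) := J.baseChange ℂ
  have hE : E * E = -1 := by
    have h1 : J ∘ₗ J = -LinearMap.id := by ext v; simp [hJ]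
    have h2 : E * E = (J ∘ₗ J).baseChange ℂ := by
      rw [LinearMap.baseChange_comp]; rfl
    rw [h2, h1, LinearMap.baseChange_neg, LinearMap.baseChange_id]; rfl
  have hP : IsIdempotentElem ((1/2 : ℂ) • (1 - Complex.I • E)) := by
    unfold IsIdempotentElem
    rw [smul_mul_smul_comm, sub_mul, mul_sub, mul_sub, smul_mul_smul_comm, hE, Complex.I_mul_I]
    simp only [one_mul, mul_one]
    module
  have ht := (LinearMap.IsIdempotentElem.isProj_range _ hP).trace
  have hb : LinearMap.trace ℂ _ E = ((LinearMap.trace ℝ W J : ℝ) : ℂ) :=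
    LinearMap.trace_baseChange J ℂ
  rw [map_smul, map_sub, map_smul, hb, LinearMap.trace_one] at ht
  have := congrArg Complex.im ht
  simpa using this

/-- for `φ ∈ S²₋`, `σ₂φ ∈ K₋` and `ρ(σ₂φ) = (2-m)φ`. -/
theorem statement7 [FiniteDimensional ℝ V] (J : V →ₗ[ℝ] V) (hJ : ∀ v, J (J v) = -v)
    (φ : V →ₗ[ℝ] V →ₗ[ℝ] ℝ) (hsym : ∀ x y, φ x y = φ y x) (hJφ : ∀ x y, φ (J x) (J y) = - φ x y)
    (S : V →ₗ[ℝ] V →ₗ[ℝ] V →ₗ[ℝ] V)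
    (hS : ∀ x y z, S x y z = φ x z • y - φ y z • x - φ x (J z) • J y + φ y (J z) • J x) :
    IsKminus J S ∧ ∀ x y, rho S x y = ((2 : ℝ) - (finrank ℝ V : ℝ)) * φ x y := by
  have hsw : ∀ x y, φ (J x) y = φ x (J y) := by
    intro x y
    have h := hJφ x (J y)
    rw [hJ, map_neg] at h
    linarith
  refine ⟨⟨⟨⟨?_, ?_⟩, ?_⟩, ?_⟩, ?_⟩
  · intro x y
    ext z
    rw [LinearMap.neg_apply, hS, hS]
    module
  · intro x y z
    rw [hS, hS, hS, hsym z y, hsym y x, hsym z x, hsym z (J y), hsym y (J x), hsym z (J x),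
      hsw, hsw, hsw]
    module
  · intro x y z
    rw [hS, hS]
    simp only [map_add, map_sub, map_smul, hJ, map_neg]
    module
  · intro x y
    ext z
    rw [LinearMap.neg_apply, hS, hS]
    simp only [hJ, hJφ, hsw]
    module
  · intro x y
    have h : (S.flip x).flip y = (φ.flip y).smulRight x - φ x y • LinearMap.id
        - (φ.flip (J y)).smulRight (J x) + φ x (J y) • J := by
      ext z
      simp [hS]
    rw [rho, h]
    simp only [map_add, map_sub, map_smul, LinearMap.trace_smulRight, LinearMap.trace_id,
      trace_J_zero J hJ, LinearMap.flip_apply, hJφ, smul_eq_mul]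
    ring
end

section
/- For every ψ ∈ Λ²₋, the operator σ₄ψ belongs to K₋ (i.e., σ₄ψ is an affine curvature operator, commutes with J, and satisfies (σ₄ψ)(Jx,Jy) = -(σ₄ψ)(x,y)), and ρ(σ₄ψ) = -(2+m)ψ. -/
open Module

variable {V : Type*} [AddCommGroup V] [Module ℝ V]

theorem trJ_zero [FiniteDimensional ℝ V] (J : V →ₗ[ℝ] V) (hJ : ∀ v, J (J v) = -v) :
    LinearMap.trace ℝ V J = 0 := by
  classical
  let b := Module.finBasis ℝ V
  let M := LinearMap.toMatrix b b J
  have hM : M * M = -1 := by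
    have h : J * J = -1 := by ext v; simp [hJ]
    have := congrArg (LinearMap.toMatrix b b) h
    rw [LinearMap.toMatrix_mul] at this
    simpa [M] using this
  let N : Matrix _ _ ℂ := M.map (algebraMap ℝ ℂ)
  have hN : N * N = -1 := by
    have := congrArg (algebraMap ℝ ℂ).mapMatrix hM
    rw [map_mul, map_neg, map_one] at this
    exact this
  have ht : N.trace = ((M.trace : ℝ) : ℂ) := by
    simp [N, Matrix.trace]
  have hr : ∀ μ ∈ N.charpoly.roots, μ.re = 0 := by
    intro μ hμ
    have h1 : Module.End.HasEigenvalue (Matrix.toLin' N) μ := by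
      rw [Module.End.hasEigenvalue_iff_isRoot_charpoly, Matrix.charpoly_toLin']
      exact Polynomial.isRoot_of_mem_roots hμ
    obtain ⟨v, hv⟩ := h1.exists_hasEigenvector
    have h2 := hv.apply_eq_smul
    have h3 : Matrix.toLin' N (Matrix.toLin' N v) = -v := by
      rw [← LinearMap.comp_apply, ← Matrix.toLin'_mul, hN]; simp
    rw [h2, map_smul, h2, smul_smul] at h3
    have h4 : (μ * μ + 1) • v = 0 := by rw [add_smul, h3]; simp
    have h5 : μ * μ + 1 = 0 := (smul_eq_zero.mp h4).resolve_right hv.2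
    have hre := congrArg Complex.re h5
    have him := congrArg Complex.im h5
    simp at hre him
    rcases (show μ.re = 0 ∨ μ.im = 0 by
      rcases mul_eq_zero.mp (show μ.re * μ.im = 0 by linarith) with h | h <;> simp [h]) with h | h
    · exact h
    · rw [h] at hre; nlinarith [mul_self_nonneg μ.re]
  have hs : ∀ s : Multiset ℂ, (∀ μ ∈ s, μ.re = 0) → s.sum.re = 0 := by
    intro s
    induction s using Multiset.induction with
    | empty => simp
    | cons a s ih =>
      intro h
      simp only [Multiset.sum_cons, Complex.add_re]
      rw [h a (by simp), ih (fun μ hμ => h μ (by simp [hμ]))]; simp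
  have := hs _ hr
  rw [← Matrix.trace_eq_sum_roots_charpoly, ht, Complex.ofReal_re] at this
  rw [LinearMap.trace_eq_matrix_trace ℝ b]; exact this

/-- for `ψ ∈ Λ²₋`, `σ₄ψ ∈ K₋` and `ρ(σ₄ψ) = -(2+m)ψ`. -/
theorem statement9 [FiniteDimensional ℝ V] (J : V →ₗ[ℝ] V) (hJ : ∀ v, J (J v) = -v)
    (φ : V →ₗ[ℝ] V →ₗ[ℝ] ℝ) (hsym : ∀ x y, φ x y = - φ y x) (hJφ : ∀ x y, φ (J x) (J y) = - φ x y)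
    (S : V →ₗ[ℝ] V →ₗ[ℝ] V →ₗ[ℝ] V)
    (hS : ∀ x y z, S x y z = φ x z • y - φ y z • x + (2 * φ x y) • z - φ x (J z) • J y + φ y (J z) • J x - (2 * φ x (J y)) • J z) :
    IsKminus J S ∧ ∀ x y, rho S x y = (-((2 : ℝ) + (finrank ℝ V : ℝ))) * φ x y := by
  have hJ1 : ∀ x y, φ (J x) y = φ x (J y) := by
    intro x y
    have := hJφ x (J y)
    rw [hJ, map_neg] at this
    linarith
  have hJs : ∀ x y, φ x (J y) = - φ y (J x) := by
    intro x y
    rw [← hJ1, hsym]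
  refine ⟨⟨⟨⟨?_, ?_⟩, ?_⟩, ?_⟩, ?_⟩
  · intro x y
    ext z
    rw [LinearMap.neg_apply, hS, hS, hsym y x, hJs y x]
    module
  · intro x y z
    rw [hS, hS, hS, hsym y x, hJs y x, hsym z x, hJs z x, hsym z y, hJs z y]
    module
  · intro x y z
    rw [hS, hS]
    simp only [map_add, map_sub, map_smul, hJ, map_neg]
    module
  · intro x y
    ext z
    rw [LinearMap.neg_apply, hS, hS]
    simp only [map_add, map_sub, map_smul, hJ, map_neg, hJ1]
    module
  · intro x y
    have h : (S.flip x).flip y = (φ.flip y).smulRight x - φ x y • LinearMap.id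
        + (2:ℝ) • (φ.flip x).smulRight y - (φ.flip (J y)).smulRight (J x)
        + φ x (J y) • J - (2:ℝ) • (φ.flip (J x)).smulRight (J y) := by
      ext z
      simp [hS, smul_smul]
    rw [rho, h]
    simp only [map_add, map_sub, map_smul, LinearMap.trace_smulRight, trJ_zero J hJ,
      LinearMap.trace_id, LinearMap.flip_apply, hJφ, smul_eq_mul]
    rw [hsym y x]
    ring
end
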